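/- In the power allocation game, there exists at least one Nash equilibrium: there is a profile p* ∈ P such that for every player i ∈ {1,…,M} and every q ∈ [0, p_i^max], the payoff φ_i evaluated at the profile obtained from p* by replacing its i-th coordinate with q is at most φ_i(p*). This holds for all choices of pricing factors α_i ≥ 0, λ_i ≥ 0 and all nonnegative channel coefficients a_{i,ℓ} with a_{i,i} > 0. -/

import Mathlib

open Finset

/-- Equivalent channel gain of player `i` under power profile `p`:
`g_i(p) = a_{i,i} / (∑_{ℓ ≠ i} a_{i,ℓ}·p_ℓ + σ²)`. -/
noncomputable def gain (M : ℕ) (σ2 : ℝ) (a : Fin M → Fin M → ℝ)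
    (p : Fin M → ℝ) (i : Fin M) : ℝ :=
  a i i / ((∑ ℓ ∈ Finset.univ.erase i, a i ℓ * p ℓ) + σ2)

/-- Payoff of player `i`: `φ_i(p) = α_i·W·log(1 + g_i(p)·p_i) − λ_i·p_i`. -/
noncomputable def payoff (M : ℕ) (W σ2 : ℝ) (α lam : Fin M → ℝ)
    (a : Fin M → Fin M → ℝ) (p : Fin M → ℝ) (i : Fin M) : ℝ :=
  α i * W * Real.log (1 + gain M σ2 a p i * p i) - lam i * p i

/-- The joint strategy set `P = ∏_{i=1}^M [0, p_i^max]`. -/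
def stratBox (M : ℕ) (pmax : Fin M → ℝ) : Set (Fin M → ℝ) :=
  {p | ∀ i, p i ∈ Set.Icc (0 : ℝ) (pmax i)}

/-- `p` is a Nash equilibrium: no player can improve its payoff by unilaterally
changing its own power within `[0, p_i^max]`. -/
def IsNE (M : ℕ) (W σ2 : ℝ) (α lam pmax : Fin M → ℝ)
    (a : Fin M → Fin M → ℝ) (p : Fin M → ℝ) : Prop :=
  ∀ i, ∀ q ∈ Set.Icc (0 : ℝ) (pmax i),
    payoff M W σ2 α lam a (Function.update p i q) i ≤ payoff M W σ2 α lam a p i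

open MeasureTheory Metric Set Topology Filter

lemma bijective_smul_add_of_lipschitz {E : Type*} [NormedAddCommGroup E] [NormedSpace ℝ E]
    [CompleteSpace E] {K : NNReal} {t : ℝ} (ht : (K : ℝ) < t)
    {u : E → E} (hu : LipschitzWith K u) : Function.Bijective fun x => t • x + u x := by
  have ht0 : 0 < t := K.coe_nonneg.trans_lt ht
  have key : ∀ y : E, ∃! x, t • x + u x = y := by
    intro y
    have hc : ContractingWith (t⁻¹.toNNReal * K) fun x => t⁻¹ • (y - u x) := by
      refine ⟨?_, LipschitzWith.of_dist_le_mul fun a b => ?_⟩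
      · rw [← NNReal.coe_lt_coe, NNReal.coe_mul, Real.coe_toNNReal _ (by positivity),
          inv_mul_lt_iff₀ ht0]
        simpa using ht
      · rw [dist_smul₀, dist_sub_left, Real.norm_of_nonneg (by positivity),
          NNReal.coe_mul, Real.coe_toNNReal _ (by positivity), mul_assoc]
        gcongr
        exact hu.dist_le_mul a b
    have hiff : ∀ x, t • x + u x = y ↔ t⁻¹ • (y - u x) = x := by
      intro x
      rw [inv_smul_eq_iff₀ ht0.ne', sub_eq_iff_eq_add, eq_comm]
    refine ⟨hc.fixedPoint, (hiff _).2 hc.fixedPoint_isFixedPt, fun x hx => ?_⟩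
    exact hc.fixedPoint_unique ((hiff x).1 hx)
  refine ⟨fun a b hab => (key _).unique hab rfl, fun y => (key y).exists⟩

lemma exists_forall_det_smul_id_add_pos {E : Type*} [NormedAddCommGroup E] [NormedSpace ℝ E]
    [FiniteDimensional ℝ E] (K : ℝ) :
    ∃ T : ℝ, ∀ t, T ≤ t → ∀ A : E →L[ℝ] E, ‖A‖ ≤ K →
      0 < (t • ContinuousLinearMap.id ℝ E + A).det := by
  have hc := (ContinuousLinearMap.continuous_det (𝕜 := ℝ) (E := E)).continuousAt
    (x := ContinuousLinearMap.id ℝ E)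
  have h1 : (0 : ℝ) < (ContinuousLinearMap.id ℝ E).det := by
    simp [ContinuousLinearMap.det]
  obtain ⟨r, hr, hball⟩ := Metric.eventually_nhds_iff.1 (hc.eventually (lt_mem_nhds h1))
  refine ⟨(|K| + 1) / r, fun t ht A hA => ?_⟩
  have ht0 : 0 < t := lt_of_lt_of_le (by positivity) ht
  have hdist : dist (ContinuousLinearMap.id ℝ E + t⁻¹ • A) (ContinuousLinearMap.id ℝ E) < r := by
    rw [dist_eq_norm, add_sub_cancel_left, norm_smul, Real.norm_of_nonneg (by positivity),
      inv_mul_lt_iff₀ ht0]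
    rw [div_le_iff₀ hr] at ht
    linarith [le_abs_self K]
  have hpos := hball hdist
  have hfac : t • ContinuousLinearMap.id ℝ E + A
      = t • (ContinuousLinearMap.id ℝ E + t⁻¹ • A) := by
    rw [smul_add, smul_inv_smul₀ ht0.ne']
  rw [hfac, ContinuousLinearMap.det, ContinuousLinearMap.toLinearMap_smul, LinearMap.det_smul]
  exact mul_pos (pow_pos ht0 _) hpos

/-- The determinant is a fixed linear combination of determinants of large shifts. -/
lemma exists_det_eq_sum_det_smul_id_add {E : Type*} [NormedAddCommGroup E] [NormedSpace ℝ E]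
    [FiniteDimensional ℝ E] (T : ℝ) :
    ∃ (c t : ℕ → ℝ), (∀ j, T ≤ t j) ∧ ∀ A : E →L[ℝ] E, A.det =
      ∑ j ∈ range (Module.finrank ℝ E + 1), c j * (t j • ContinuousLinearMap.id ℝ E + A).det := by
  let t : ℕ → ℝ := fun j => T + j
  let s := range (Module.finrank ℝ E + 1)
  have ht : Set.InjOn t s := fun i _ j _ hij => by simpa [t] using hij
  refine ⟨fun j => (Lagrange.basis s t j).eval 0, t, fun j => by simp [t], fun A => ?_⟩
  set p := LinearMap.charpoly (-(A : E →ₗ[ℝ] E)) with hp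
  have hev : ∀ r : ℝ, p.eval r = (r • ContinuousLinearMap.id ℝ E + A).det := by
    intro r
    rw [hp, LinearMap.eval_charpoly, sub_neg_eq_add, ContinuousLinearMap.det]
    congr 1
  have hdeg : p.degree < #s := by
    refine lt_of_le_of_lt Polynomial.degree_le_natDegree ?_
    rw [hp, LinearMap.charpoly_natDegree]
    simpa [s] using mod_cast Nat.lt_succ_self (Module.finrank ℝ E)
  have h0 := congrArg (Polynomial.eval 0) (Lagrange.eq_interpolate ht hdeg)
  rw [hev 0, zero_smul, zero_add, Lagrange.interpolate_apply, Polynomial.eval_finsetSum] at h0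
  rw [h0]
  refine Finset.sum_congr rfl fun j _ => ?_
  rw [Polynomial.eval_mul, Polynomial.eval_C, hev, mul_comm]

/-- The integral of a Jacobian determinant over a compact set depends only on the values of the
map off that set. -/
theorem setIntegral_det_eq_of_eqOn_compl {E : Type*} [NormedAddCommGroup E] [NormedSpace ℝ E]
    [FiniteDimensional ℝ E] [MeasurableSpace E] [BorelSpace E] (μ : Measure E) [μ.IsAddHaarMeasure]
    {u v : E → E} {u' v' : E → E →L[ℝ] E} {K : NNReal} {B : Set E} (hB : IsCompact B)
    (hu : ∀ x, HasFDerivAt u (u' x) x) (hv : ∀ x, HasFDerivAt v (v' x) x)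
    (hu' : Continuous u') (hv' : Continuous v')
    (hul : LipschitzWith K u) (hvl : LipschitzWith K v) (huv : EqOn u v Bᶜ) :
    ∫ x in B, (u' x).det ∂μ = ∫ x in B, (v' x).det ∂μ := by
  obtain ⟨T, hT⟩ := exists_forall_det_smul_id_add_pos (E := E) K
  obtain ⟨c, t, ht, hdet⟩ := exists_det_eq_sum_det_smul_id_add (E := E) (max T (K + 1))
  have himage : ∀ (w : E → E), LipschitzWith K w → ∀ j,
      (fun x => t j • x + w x) '' B = ((fun x => t j • x + w x) '' Bᶜ)ᶜ := by
    intro w hw j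
    have hlt : (K : ℝ) < t j := by linarith [(le_max_right T (K + 1 : ℝ)).trans (ht j)]
    rw [← image_compl_eq (bijective_smul_add_of_lipschitz hlt hw), compl_compl]
  have hvol : ∀ (w : E → E) (w' : E → E →L[ℝ] E), LipschitzWith K w →
      (∀ x, HasFDerivAt w (w' x) x) → ∀ j,
      ∫ x in B, (t j • ContinuousLinearMap.id ℝ E + w' x).det ∂μ
        = μ.real ((fun x => t j • x + w x) '' B) := by
    intro w w' hw hwd j
    have hlt : (K : ℝ) < t j := by linarith [(le_max_right T (K + 1 : ℝ)).trans (ht j)]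
    have hinj := (bijective_smul_add_of_lipschitz hlt hw).injective
    have h := integral_image_eq_integral_abs_det_fderiv_smul μ hB.measurableSet
      (f' := fun x => t j • ContinuousLinearMap.id ℝ E + w' x)
      (fun x _ => (((hasFDerivAt_id x).const_smul (t j)).add (hwd x)).hasFDerivWithinAt)
      hinj.injOn (fun _ => (1 : ℝ))
    simp only [smul_eq_mul, mul_one, integral_const, measureReal_restrict_apply_univ] at h
    refine Eq.trans ?_ h.symm
    refine integral_congr_ae (ae_of_all _ fun x => ?_)
    exact (abs_of_pos (hT _ ((le_max_left _ _).trans (ht j)) _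
      ((hwd x).le_of_lipschitz hw))).symm
  have hexp : ∀ (w' : E → E →L[ℝ] E), Continuous w' → ∫ x in B, (w' x).det ∂μ =
      ∑ j ∈ range (Module.finrank ℝ E + 1),
        c j * ∫ x in B, (t j • ContinuousLinearMap.id ℝ E + w' x).det ∂μ := by
    intro w' hw'
    simp_rw [← integral_const_mul]
    rw [← integral_finsetSum]
    · exact integral_congr_ae (ae_of_all _ fun x => hdet (w' x))
    · intro j _
      exact (continuous_const.mul (ContinuousLinearMap.continuous_det.comp
        (continuous_const.add hw'))).continuousOn.integrableOn_compact hB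
  rw [hexp u' hu', hexp v' hv']
  refine Finset.sum_congr rfl fun j _ => ?_
  rw [hvol u u' hul hu, hvol v v' hvl hv, himage u hul, himage v hvl]
  have himg : (fun x => t j • x + u x) '' Bᶜ = (fun x => t j • x + v x) '' Bᶜ :=
    image_congr fun x hx => by rw [huv hx]
  rw [himg]

/-- A bounded `C¹` self-map of `ℝⁿ` has a fixed point. -/
theorem exists_fixedPoint_of_contDiff_of_bounded {n : ℕ} {S : (Fin n → ℝ) → Fin n → ℝ} {R : ℝ}
    (hS : ContDiff ℝ 1 S) (hR : ∀ x, ‖S x‖ ≤ R) : ∃ x, S x = x := by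
  by_contra! hne
  have hR0 : 0 ≤ R := (norm_nonneg _).trans (hR 0)
  let χ : ContDiffBump (0 : Fin n → ℝ) := ⟨R + 1, R + 2, by linarith, by linarith⟩
  let P : (Fin n → ℝ) → Fin n → ℝ := fun x => χ x • S x
  let H : (Fin n → ℝ) → Fin n → ℝ := fun x => x - P x
  let B : Set (Fin n → ℝ) := closedBall 0 (R + 2)
  have hB : IsCompact B := isCompact_closedBall _ _
  have hP : ContDiff ℝ 1 P := χ.contDiff.smul hS
  have hH : ContDiff ℝ 1 H := contDiff_id.sub hP
  have hPB : ∀ x ∉ B, P x = 0 := by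
    intro x hx
    have hx' : R + 2 < dist x 0 := by simpa [B] using hx
    simp only [P]
    rw [χ.zero_of_le_dist hx'.le, zero_smul]
  have hHne : ∀ x, H x ≠ 0 := by
    intro x hx
    have hxP : x = χ x • S x := sub_eq_zero.1 hx
    have hnorm : ‖x‖ ≤ R := by
      rw [hxP, norm_smul, Real.norm_of_nonneg χ.nonneg]
      exact (mul_le_of_le_one_left (norm_nonneg _) χ.le_one).trans (hR x)
    have hone : χ x = 1 := χ.one_of_mem_closedBall (by
      rw [mem_closedBall, dist_zero_right]
      change ‖x‖ ≤ R + 1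
      linarith)
    rw [hone, one_smul] at hxP
    exact hne x hxP.symm
  obtain ⟨δ, hδ, hδH⟩ : ∃ δ > 0, ∀ x, δ ≤ ‖H x‖ := by
    obtain ⟨z, -, hz⟩ := hB.exists_isMinOn ⟨0, mem_closedBall_self (by linarith)⟩
      hH.continuous.norm.continuousOn
    refine ⟨min ‖H z‖ 1, lt_min (norm_pos_iff.2 (hHne z)) one_pos, fun x => ?_⟩
    by_cases hx : x ∈ B
    · exact (min_le_left _ _).trans (hz hx)
    · refine (min_le_right _ _).trans ?_
      have hx' : R + 2 < ‖x‖ := by simpa [B] using hx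
      simp only [H, hPB x hx, sub_zero]
      linarith
  let φ : ℝ → ℝ := fun s => max 0 (δ - |s|)
  let m : ℝ → ℝ := fun s => ∫ r in (0 : ℝ)..s, φ r
  have hφ : Continuous φ := by fun_prop
  have hφ0 : ∀ s, 0 ≤ φ s := fun s => le_max_left _ _
  have hφδ : ∀ s, φ s ≤ δ := fun s => max_le hδ.le (by linarith [abs_nonneg s])
  have hm : ∀ s, HasDerivAt m (φ s) s := fun s => hφ.integral_hasStrictDerivAt 0 s |>.hasDerivAt
  have hmlip : LipschitzWith δ.toNNReal m := by
    refine lipschitzWith_of_nnnorm_deriv_le (fun s => (hm s).differentiableAt) fun s => ?_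
    rw [(hm s).deriv, ← NNReal.coe_le_coe, coe_nnnorm, Real.coe_toNNReal _ hδ.le,
      Real.norm_of_nonneg (hφ0 s)]
    exact hφδ s
  let ψ : (Fin n → ℝ) → Fin n → ℝ := fun y i => m (y i)
  let ψ' : (Fin n → ℝ) → (Fin n → ℝ) →L[ℝ] (Fin n → ℝ) := fun y =>
    ContinuousLinearMap.pi fun i => φ (y i) • ContinuousLinearMap.proj (R := ℝ) i
  have hψ : ∀ y, HasFDerivAt ψ (ψ' y) y := fun y => hasFDerivAt_pi.2 fun i =>
    (hm (y i)).comp_hasFDerivAt (f := fun y : Fin n → ℝ => y i) y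
      (ContinuousLinearMap.proj (R := ℝ) (φ := fun _ => ℝ) i).hasFDerivAt
  have hψ' : Continuous ψ' := by
    refine continuous_clm_apply.2 fun z => continuous_pi fun i => ?_
    simp only [ψ', ContinuousLinearMap.pi_apply, smul_apply]
    fun_prop
  have hψlip : LipschitzWith δ.toNNReal ψ := LipschitzWith.of_dist_le_mul fun a b => by
    refine (dist_pi_le_iff (by positivity)).2 fun i => ?_
    refine (hmlip.dist_le_mul _ _).trans ?_
    gcongr
    exact dist_le_pi_dist a b i
  have hdetψ : ∀ y, (ψ' y).det = ∏ i, φ (y i) := by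
    intro y
    rw [ContinuousLinearMap.det, ← LinearMap.det_toMatrix', ← Matrix.det_diagonal]
    congr 1
    ext i j
    simp [ψ', LinearMap.toMatrix'_apply, Matrix.diagonal_apply, Pi.single_apply]
  have hdetH : ∀ x, ((ψ' (H x)).comp (fderiv ℝ H x)).det = 0 := by
    intro x
    obtain ⟨i, hi⟩ : ∃ i, δ ≤ |H x i| := by
      by_contra! hlt
      exact (hδH x).not_gt ((pi_norm_lt_iff hδ).2 hlt)
    rw [ContinuousLinearMap.det, ContinuousLinearMap.toLinearMap_comp, LinearMap.det_comp]
    refine mul_eq_zero_of_left ((hdetψ (H x)).trans ?_) _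
    exact Finset.prod_eq_zero (Finset.mem_univ i) (max_eq_left (by linarith))
  obtain ⟨C, hC⟩ := hP.lipschitzWith_of_hasCompactSupport
    (HasCompactSupport.intro hB hPB) one_ne_zero
  have hHlip : LipschitzWith (1 + C) H := LipschitzWith.id.sub hC
  have hKψ := hψlip.weaken (le_max_left _ (δ.toNNReal * (1 + C)))
  have hKH := (hψlip.comp hHlip).weaken (le_max_right δ.toNNReal _)
  have heq := setIntegral_det_eq_of_eqOn_compl volume hB
    (u' := fun x => (ψ' (H x)).comp (fderiv ℝ H x))
    (fun x => (hψ (H x)).comp x (hH.differentiable one_ne_zero x).hasFDerivAt) hψ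
    ((hψ'.comp hH.continuous).clm_comp (hH.continuous_fderiv one_ne_zero)) hψ' hKH hKψ
    (fun x hx => by simp [H, hPB x hx])
  simp only [hdetH, hdetψ, integral_zero] at heq
  have hcont : Continuous fun y : Fin n → ℝ => ∏ i, φ (y i) := by fun_prop
  have hpos : 0 < ∫ y in B, ∏ i, φ (y i) := by
    rw [setIntegral_pos_iff_support_of_nonneg_ae
      (ae_of_all _ fun y => Finset.prod_nonneg fun i _ => hφ0 (y i))
      (hcont.continuousOn.integrableOn_compact hB)]
    have hopen : IsOpen (Function.support (fun y : Fin n → ℝ => ∏ i, φ (y i)) ∩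
        ball 0 (R + 2)) := hcont.isOpen_support.inter isOpen_ball
    refine (hopen.measure_pos volume ⟨0, ?_, mem_ball_self (by linarith)⟩).trans_le
      (measure_mono (inter_subset_inter_right _ ball_subset_closedBall))
    simp [φ, hδ.le, hδ.ne']
  exact hpos.ne heq

/-- A smooth approximation, as `ε → 0`, of the projection of `ℝ` onto `[0, b]`. -/
noncomputable def smoothClamp (ε b x : ℝ) : ℝ :=
  (√(x ^ 2 + ε) - √((x - b) ^ 2 + ε) + b) / 2

lemma smoothClamp_zero {b : ℝ} (hb : 0 ≤ b) (x : ℝ) : smoothClamp 0 b x = max 0 (min b x) := by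
  rw [smoothClamp, add_zero, add_zero, Real.sqrt_sq_eq_abs, Real.sqrt_sq_eq_abs]
  rcases le_total x 0 with h | h
  · rw [abs_of_nonpos h, abs_of_nonpos (by linarith), min_eq_right (by linarith), max_eq_left h]
    ring
  · rcases le_total x b with h' | h'
    · rw [abs_of_nonneg h, abs_of_nonpos (by linarith), min_eq_right h', max_eq_right h]
      ring
    · rw [abs_of_nonneg h, abs_of_nonneg (by linarith), min_eq_left h', max_eq_right hb]
      ring

lemma sqrt_sq_add_le {ε : ℝ} (hε : 0 ≤ ε) (x y : ℝ) :
    √(x ^ 2 + ε) ≤ √(y ^ 2 + ε) + |x - y| := by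
  have hs := Real.sq_sqrt (show 0 ≤ y ^ 2 + ε by positivity)
  have hy : |y| ≤ √(y ^ 2 + ε) := Real.abs_le_sqrt (by linarith)
  refine Real.sqrt_le_iff.2 ⟨by positivity, ?_⟩
  have hcross : y * (x - y) ≤ √(y ^ 2 + ε) * |x - y| :=
    (le_abs_self _).trans ((abs_mul _ _).trans_le (by gcongr))
  nlinarith [sq_abs (x - y)]

lemma smoothClamp_mem_Icc {ε b : ℝ} (hε : 0 ≤ ε) (hb : 0 ≤ b) (x : ℝ) :
    smoothClamp ε b x ∈ Icc 0 b := by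
  have h1 := sqrt_sq_add_le hε x (x - b)
  have h2 := sqrt_sq_add_le hε (x - b) x
  rw [sub_sub_cancel, abs_of_nonneg hb] at h1
  rw [sub_sub_cancel_left, abs_neg, abs_of_nonneg hb] at h2
  rw [smoothClamp]
  constructor <;> linarith

/-- The composition of a `C¹` map with the projection onto a box has a fixed point. -/
theorem exists_eq_max_min_of_contDiff {n : ℕ} {b : Fin n → ℝ} (hb : ∀ i, 0 ≤ b i)
    {L : (Fin n → ℝ) → Fin n → ℝ} (hL : ContDiff ℝ 1 L) :
    ∃ p, ∀ i, p i = max 0 (min (b i) (L p i)) := by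
  have happrox : ∀ k : ℕ, ∃ p : Fin n → ℝ,
      ∀ i, smoothClamp (1 / ((k : ℝ) + 1)) (b i) (L p i) = p i := by
    intro k
    have hε : (0 : ℝ) < 1 / ((k : ℝ) + 1) := by positivity
    obtain ⟨p, hp⟩ := exists_fixedPoint_of_contDiff_of_bounded (R := ‖b‖)
      (S := fun p i => smoothClamp (1 / ((k : ℝ) + 1)) (b i) (L p i)) (by
        refine contDiff_pi.2 fun i => ?_
        have hLi : ContDiff ℝ 1 fun p => L p i := contDiff_pi.1 hL i
        exact ((((hLi.pow 2).add contDiff_const).sqrt fun p => by positivity).sub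
          ((((hLi.sub contDiff_const).pow 2).add contDiff_const).sqrt fun p => by positivity)
          |>.add contDiff_const).div_const 2)
      (fun p => (pi_norm_le_iff_of_nonneg (norm_nonneg b)).2 fun i => by
        have h := smoothClamp_mem_Icc hε.le (hb i) (L p i)
        rw [Real.norm_of_nonneg h.1]
        exact h.2.trans ((le_abs_self _).trans (norm_le_pi_norm b i)))
    exact ⟨p, fun i => congrFun hp i⟩
  choose p hp using happrox
  have hpb : ∀ k, p k ∈ Set.Icc 0 b := fun k => by
    have h : ∀ i, p k i ∈ Set.Icc 0 (b i) := fun i => by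
      rw [← hp k i]
      exact smoothClamp_mem_Icc (by positivity) (hb i) _
    exact ⟨fun i => (h i).1, fun i => (h i).2⟩
  obtain ⟨q, -, θ, hθ, hq⟩ := isCompact_Icc.tendsto_subseq hpb
  refine ⟨q, fun i => ?_⟩
  have hlim := tendsto_one_div_add_atTop_nhds_zero_nat (𝕜 := ℝ) |>.comp hθ.tendsto_atTop
  have hcont : Continuous fun z : ℝ × (Fin n → ℝ) => smoothClamp z.1 (b i) (L z.2 i) := by
    have hLc := hL.continuous
    unfold smoothClamp
    fun_prop
  have h1 := (hcont.tendsto (0, q)).comp (hlim.prodMk_nhds hq)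
  have h2 : Tendsto (fun k => p (θ k) i) atTop (𝓝 (q i)) :=
    (continuous_apply i).continuousAt.tendsto.comp hq
  rw [← smoothClamp_zero (hb i)]
  refine tendsto_nhds_unique h2 (h1.congr fun k => ?_)
  exact hp (θ k) i

/-- The payoff of a single user is maximized on `[0, P]` by the projected water-filling level. -/
lemma log_sub_linear_le_of_eq_clamp {A l g P x q : ℝ} (hA : 0 < A) (hl : 0 < l) (hg : 0 < g)
    (hx : x = max 0 (min P (A / l - g⁻¹))) (hP : 0 ≤ P) (hq : q ∈ Icc 0 P) :
    A * Real.log (1 + g * q) - l * q ≤ A * Real.log (1 + g * x) - l * x := by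
  have hx0 : 0 ≤ x := hx ▸ le_max_left _ _
  have hX : 0 < 1 + g * x := by positivity
  have hQ : 0 < 1 + g * q := by have := hq.1; positivity
  have hlog : Real.log (1 + g * q) - Real.log (1 + g * x) ≤ g * (q - x) / (1 + g * x) := by
    rw [← Real.log_div hQ.ne' hX.ne']
    refine (Real.log_le_sub_one_of_pos (div_pos hQ hX)).trans_eq ?_
    field_simp
    ring
  have hslope : (A * g - l * (1 + g * x)) * (q - x) ≤ 0 := by
    have hfac : A * g - l * (1 + g * x) = l * g * (A / l - g⁻¹ - x) := by
      field_simp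
      ring
    rw [hfac, mul_assoc]
    refine mul_nonpos_of_nonneg_of_nonpos (by positivity) ?_
    rcases le_total (A / l - g⁻¹) 0 with h | h
    · rw [min_eq_right (h.trans hP), max_eq_left h] at hx
      exact mul_nonpos_of_nonpos_of_nonneg (by linarith) (by linarith [hq.1])
    · rcases le_total (A / l - g⁻¹) P with h' | h'
      · rw [min_eq_right h', max_eq_right h] at hx
        simp [hx]
      · rw [min_eq_left h', max_eq_right hP] at hx
        exact mul_nonpos_of_nonneg_of_nonpos (by linarith) (by linarith [hq.2])
  have hA' := mul_le_mul_of_nonneg_left hlog hA.le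
  have hslope' : A * (g * (q - x) / (1 + g * x)) - l * (q - x) ≤ 0 := by
    have : A * (g * (q - x) / (1 + g * x)) - l * (q - x)
        = (A * g - l * (1 + g * x)) * (q - x) / (1 + g * x) := by
      field_simp
    rw [this]
    exact div_nonpos_of_nonpos_of_nonneg hslope hX.le
  linarith

lemma gain_update_self (M : ℕ) (σ2 : ℝ) (a : Fin M → Fin M → ℝ) (p : Fin M → ℝ) (i : Fin M)
    (q : ℝ) : gain M σ2 a (Function.update p i q) i = gain M σ2 a p i := by
  unfold gain
  congr 2
  refine Finset.sum_congr rfl fun ℓ hℓ => ?_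
  rw [Function.update_of_ne (Finset.ne_of_mem_erase hℓ)]

/-- **Lemma 2, existence of NE.** The power allocation game always
admits at least one pure-strategy Nash equilibrium, for all pricing factors
`α_i ≥ 0`, `λ_i ≥ 0` and all nonnegative channel coefficients with `a_{i,i} > 0`. -/
theorem exists_nash_equilibrium (M : ℕ) (hM : 1 ≤ M) (W σ2 : ℝ)
    (hW : 0 < W) (hσ2 : 0 < σ2) (α lam pmax : Fin M → ℝ)
    (a : Fin M → Fin M → ℝ)
    (hα : ∀ i, 0 ≤ α i) (hlam : ∀ i, 0 ≤ lam i) (hpmax : ∀ i, 0 < pmax i)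
    (ha : ∀ i ℓ, 0 ≤ a i ℓ) (haii : ∀ i, 0 < a i i) :
    ∃ pstar ∈ stratBox M pmax,
      ∀ i, ∀ q ∈ Set.Icc (0 : ℝ) (pmax i),
        payoff M W σ2 α lam a (Function.update pstar i q) i ≤
          payoff M W σ2 α lam a pstar i := by
  let L : (Fin M → ℝ) → Fin M → ℝ := fun p i =>
    if α i = 0 then 0
    else if lam i = 0 then pmax i
    else α i * W / lam i - ((∑ ℓ ∈ Finset.univ.erase i, a i ℓ * p ℓ) + σ2) / a i i
  have hL : ContDiff ℝ 1 L := by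
    refine contDiff_pi.2 fun i => ?_
    simp only [L]
    split_ifs <;> fun_prop
  obtain ⟨p, hp⟩ := exists_eq_max_min_of_contDiff (fun i => (hpmax i).le) hL
  have hpbox : p ∈ stratBox M pmax := fun i => by
    rw [hp i]
    exact ⟨le_max_left _ _, max_le (hpmax i).le (min_le_left _ _)⟩
  refine ⟨p, hpbox, fun i q hq => ?_⟩
  have hden : 0 < (∑ ℓ ∈ Finset.univ.erase i, a i ℓ * p ℓ) + σ2 :=
    add_pos_of_nonneg_of_pos
      (Finset.sum_nonneg fun ℓ _ => mul_nonneg (ha i ℓ) (hpbox ℓ).1) hσ2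
  have hg : 0 < gain M σ2 a p i := div_pos (haii i) hden
  have hpi := hp i
  simp only [L] at hpi
  unfold payoff
  rw [gain_update_self, Function.update_self]
  split_ifs at hpi with h1 h2
  · rw [min_eq_right (hpmax i).le, max_self] at hpi
    simpa [h1, hpi] using mul_nonneg (hlam i) hq.1
  · rw [min_self, max_eq_right (hpmax i).le] at hpi
    rw [h2, zero_mul, zero_mul, sub_zero, sub_zero, hpi]
    have hq0 := hq.1
    refine mul_le_mul_of_nonneg_left (Real.log_le_log (by positivity) ?_)
      (mul_nonneg (hα i) hW.le)
    gcongr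
    exact hq.2
  · refine log_sub_linear_le_of_eq_clamp (mul_pos ((hα i).lt_of_ne' h1) hW)
      ((hlam i).lt_of_ne' h2) hg ?_ (hpmax i).le hq
    rw [gain, inv_div]
    exact hpi
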